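/- Let c ∈ ℝ⁴ be a base quadruple of a bounded Apollonian packing and let s ∈ ℝ⁴. If there exists w ∈ W* such that at least two coordinates of w·s are ≤ 0, then the family (exp(−⟨w·c, s⟩))_{w ∈ W} is not summable. -/

import Mathlib

open Finset Complex

noncomputable section

/-- The Descartes quadratic form `F(x) = 2(x₁²+x₂²+x₃²+x₄²) − (x₁+x₂+x₃+x₄)²`. -/
def DescartesF (x : Fin 4 → ℝ) : ℝ := 2 * (∑ i, (x i)^2) - (∑ i, x i)^2

/-- Height of a vector: the sum of its coordinates. -/
def ht (x : Fin 4 → ℝ) : ℝ := ∑ i, x i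

/-- The Apollonian reflection as a linear map: it replaces the `i`-th coordinate `xᵢ`
by `2(Σ_{j≠i} xⱼ) − xᵢ = 2(Σ_j xⱼ) − 3xᵢ` and fixes the other coordinates. -/
def sigmaL (i : Fin 4) : (Fin 4 → ℝ) →ₗ[ℝ] (Fin 4 → ℝ) where
  toFun x := Function.update x i (2 * (∑ j, x j) - 3 * x i)
  map_add' x y := by
    funext j
    rcases eq_or_ne j i with h | h
    · subst h; simp [Function.update_self, Finset.sum_add_distrib]; ring
    · simp [Function.update_of_ne h]
  map_smul' r x := by
    funext j
    rcases eq_or_ne j i with h | h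
    · subst h
      simp only [Pi.smul_apply, smul_eq_mul, Function.update_self, RingHom.id_apply]
      rw [← Finset.mul_sum]
      ring
    · simp [Function.update_of_ne h]

lemma sigmaL_invol (i : Fin 4) : Function.Involutive (sigmaL i) := by
  intro x
  funext j
  have hsum : ∑ k, Function.update x i (2 * (∑ j, x j) - 3 * x i) k
      = 3 * (∑ k, x k) - 4 * x i := by
    rw [Finset.sum_update_of_mem (Finset.mem_univ i)]
    have : ∑ k ∈ Finset.univ \ {i}, x k = (∑ k, x k) - x i := by
      rw [Finset.sum_sdiff_eq_sub (Finset.subset_univ _), Finset.sum_singleton]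
    rw [this]; ring
  rcases eq_or_ne j i with h | h
  · subst h
    simp only [sigmaL, LinearMap.coe_mk, AddHom.coe_mk, Function.update_self, hsum]
    ring
  · simp [sigmaL, Function.update_of_ne h]

/-- The Apollonian reflection `σᵢ` as a linear automorphism of `ℝ⁴`. -/
def apSigma (i : Fin 4) : (Fin 4 → ℝ) ≃ₗ[ℝ] (Fin 4 → ℝ) :=
  LinearEquiv.ofInvolutive (sigmaL i) (sigmaL_invol i)

/-- The Apollonian group `W`, generated by the four reflections `σ₁, σ₂, σ₃, σ₄`. -/
def apW : Subgroup ((Fin 4 → ℝ) ≃ₗ[ℝ] (Fin 4 → ℝ)) :=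
  Subgroup.closure {apSigma 0, apSigma 1, apSigma 2, apSigma 3}

/-- The pairing `⟨x,s⟩ = x₁s₁+x₂s₂+x₃s₃+x₄s₄` of real vectors. -/
def pairR (x s : Fin 4 → ℝ) : ℝ := ∑ i, x i * s i

/-- `c` is a base quadruple of a bounded Apollonian packing: `F(c) = 0`, exactly one
coordinate of `c` is negative, and `2cᵢ ≤ ht(c)` for every `i`. -/
def IsBaseQuadruple (c : Fin 4 → ℝ) : Prop :=
  DescartesF c = 0 ∧ (∃! i, c i < 0) ∧ ∀ i, 2 * c i ≤ ht c

/-- The dual Apollonian reflection as a linear map: it sends `s` to the vector with `i`-th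
coordinate `−sᵢ` and `j`-th coordinate `sⱼ + 2sᵢ` for `j ≠ i`. -/
def tauL (i : Fin 4) : (Fin 4 → ℝ) →ₗ[ℝ] (Fin 4 → ℝ) where
  toFun s := fun j => if j = i then -s i else s j + 2 * s i
  map_add' x y := by
    funext j
    rcases eq_or_ne j i with h | h <;> simp [h] <;> ring
  map_smul' r x := by
    funext j
    rcases eq_or_ne j i with h | h <;> simp [h] <;> ring

lemma tauL_invol (i : Fin 4) : Function.Involutive (tauL i) := by
  intro x
  funext j
  rcases eq_or_ne j i with h | h <;> simp [tauL, h] <;> ring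

/-- The dual Apollonian reflection `τᵢ` (the transpose of `σᵢ`) as a linear automorphism. -/
def apTau (i : Fin 4) : (Fin 4 → ℝ) ≃ₗ[ℝ] (Fin 4 → ℝ) :=
  LinearEquiv.ofInvolutive (tauL i) (tauL_invol i)

/-- The dual Apollonian group `W* = ⟨τ₁, τ₂, τ₃, τ₄⟩`. -/
def apWstar : Subgroup ((Fin 4 → ℝ) ≃ₗ[ℝ] (Fin 4 → ℝ)) :=
  Subgroup.closure {apTau 0, apTau 1, apTau 2, apTau 3}

lemma aux_pos (a b p q : ℝ) (hF : 2 * (a^2+b^2+p^2+q^2) - (a+b+p+q)^2 = 0)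
    (h1 : 2 * a ≤ a+b+p+q) (h2 : 2 * b ≤ a+b+p+q)
    (hn : a < 0 ∨ b < 0 ∨ p < 0 ∨ q < 0) (hab : ¬ (a < 0 ∧ b < 0)) : 0 < p + q := by
  have key : (p-q)^2 + (a-b)^2 = 2 * (a+b) * (p+q) := by nlinarith
  rcases lt_trichotomy (p+q) 0 with h | h | h
  · exfalso
    have hT : a + b ≤ 0 := by
      by_contra hc
      push Not at hc
      nlinarith [sq_nonneg (p-q), sq_nonneg (a-b), mul_pos_of_neg_of_neg h (neg_lt_zero.mpr hc)]
    exact hab ⟨by linarith, by linarith⟩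
  · exfalso
    rw [h] at key
    have e1 : p - q = 0 := by nlinarith [sq_nonneg (p-q), sq_nonneg (a-b)]
    have e2 : a - b = 0 := by nlinarith [sq_nonneg (p-q), sq_nonneg (a-b)]
    rcases hn with h | h | h | h
    · exact hab ⟨h, by linarith⟩
    · exact hab ⟨by linarith, h⟩
    · linarith
    · linarith
  · exact h

lemma base_pos (c : Fin 4 → ℝ) (hc : IsBaseQuadruple c) (i j : Fin 4) (hij : i ≠ j) :
    0 < (∑ k, c k) - c i - c j := by
  obtain ⟨hF, ⟨m, hm, hu⟩, hb⟩ := hc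
  have hab : ¬ (c i < 0 ∧ c j < 0) := fun h => hij ((hu i h.1).trans (hu j h.2).symm)
  have hn : c 0 < 0 ∨ c 1 < 0 ∨ c 2 < 0 ∨ c 3 < 0 := by
    clear hu
    fin_cases m <;> simp_all
  have h1 := hb i
  have h2 := hb j
  simp only [DescartesF, ht, Fin.sum_univ_four] at *
  have key : ∀ p q : ℝ, c i + c j + p + q = c 0 + c 1 + c 2 + c 3 →
      (c i)^2 + (c j)^2 + p^2 + q^2 = c 0 ^2 + c 1 ^2+ c 2 ^2+ c 3 ^2 →
      (c i < 0 ∨ c j < 0 ∨ p < 0 ∨ q < 0) → 0 < c 0 + c 1 + c 2 + c 3 - c i - c j := by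
    intro p q e1 e2 e3
    have := aux_pos (c i) (c j) p q (by rw [e1, e2]; exact hF) (by rw [e1]; exact h1)
      (by rw [e1]; exact h2) e3 hab
    linarith
  have : ∃ k l : Fin 4, c i + c j + c k + c l = c 0 + c 1 + c 2 + c 3 ∧
      (c i)^2 + (c j)^2 + (c k)^2 + (c l)^2 = c 0 ^2 + c 1 ^2+ c 2 ^2+ c 3 ^2 ∧
      (c i < 0 ∨ c j < 0 ∨ c k < 0 ∨ c l < 0) := by
    have hp : ∀ i j : Fin 4, i ≠ j → ∃ k l : Fin 4, i ≠ k ∧ i ≠ l ∧ j ≠ k ∧ j ≠ l ∧ k ≠ l := by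
      decide
    obtain ⟨k, l, a1, a2, a3, a4, a5⟩ := hp i j hij
    have hset : (Finset.univ : Finset (Fin 4)) = {i, j, k, l} := by
      symm
      apply Finset.eq_univ_of_card
      simp [*]
    have hs : ∀ f : Fin 4 → ℝ, f i + f j + f k + f l = f 0 + f 1 + f 2 + f 3 := by
      intro f
      rw [← Fin.sum_univ_four, hset, Finset.sum_insert (by simp [*]),
        Finset.sum_insert (by simp [*]), Finset.sum_insert (by simp [*]), Finset.sum_singleton]
      ring
    have hmm : m ∈ ({i, j, k, l} : Finset (Fin 4)) := hset ▸ Finset.mem_univ m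
    simp only [Finset.mem_insert, Finset.mem_singleton] at hmm
    refine ⟨k, l, hs c, hs (fun x => c x ^ 2), ?_⟩
    rcases hmm with e | e | e | e <;> rw [e] at hm <;> simp [hm]
  obtain ⟨k, l, e1, e2, e3⟩ := this
  exact key _ _ e1 e2 e3

lemma apSigma_mem (i : Fin 4) : apSigma i ∈ apW := by
  apply Subgroup.subset_closure
  fin_cases i <;> simp

lemma apSigma_apply (i : Fin 4) (x : Fin 4 → ℝ) :
    apSigma i x = Function.update x i (2 * (∑ j, x j) - 3 * x i) := rfl

lemma apTau_apply (i : Fin 4) (x : Fin 4 → ℝ) :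
    apTau i x = fun j => if j = i then -x i else x j + 2 * x i := rfl

lemma pair_sigma (i : Fin 4) (x s : Fin 4 → ℝ) :
    pairR (apSigma i x) s = pairR x (apTau i s) := by
  rw [apSigma_apply, apTau_apply]
  unfold pairR
  simp only [Fin.sum_univ_four]
  fin_cases i <;> simp [Function.update] <;> ring

lemma exists_adj (w : (Fin 4 → ℝ) ≃ₗ[ℝ] (Fin 4 → ℝ)) (hw : w ∈ apWstar) :
    ∃ u ∈ apW, ∀ x s, pairR (u x) s = pairR x (w s) := by
  unfold apWstar at hw
  induction hw using Subgroup.closure_induction with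
  | mem x hx =>
    simp only [Set.mem_insert_iff, Set.mem_singleton_iff] at hx
    rcases hx with h | h | h | h <;> subst h <;> exact ⟨_, apSigma_mem _, pair_sigma _⟩
  | one => exact ⟨1, one_mem _, fun x s => rfl⟩
  | mul a b _ _ ha hb =>
    obtain ⟨u, hu, hu'⟩ := ha
    obtain ⟨v, hv, hv'⟩ := hb
    refine ⟨v * u, mul_mem hv hu, fun x s => ?_⟩
    rw [LinearEquiv.mul_apply, LinearEquiv.mul_apply, hv', hu']
  | inv a _ ha =>
    obtain ⟨u, hu, hu'⟩ := ha
    refine ⟨u⁻¹, inv_mem hu, fun x s => ?_⟩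
    have h := hu' (u⁻¹ x) (a⁻¹ s)
    rw [← LinearEquiv.mul_apply, ← LinearEquiv.mul_apply, mul_inv_cancel, mul_inv_cancel] at h
    exact h.symm

lemma sum_apSigma (i : Fin 4) (x : Fin 4 → ℝ) :
    ∑ k, apSigma i x k = 3 * (∑ k, x k) - 4 * x i := by
  rw [apSigma_apply, Finset.sum_update_of_mem (Finset.mem_univ i),
    Finset.sum_sdiff_eq_sub (Finset.subset_univ _), Finset.sum_singleton]
  ring

lemma iter (i j : Fin 4) (hij : i ≠ j) (c : Fin 4 → ℝ) (n : ℕ) :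
    (((apSigma j * apSigma i)^n) c i = c i + (2*n) * (c j - c i)
        + ((∑ k, c k) - c i - c j) * ((2*n)*(2*n-1))) ∧
    (((apSigma j * apSigma i)^n) c j = c i + (2*n+1) * (c j - c i)
        + ((∑ k, c k) - c i - c j) * ((2*n+1)*(2*n))) ∧
    (∀ k, k ≠ i → k ≠ j → ((apSigma j * apSigma i)^n) c k = c k) ∧
    ((∑ k, ((apSigma j * apSigma i)^n) c k) - ((apSigma j * apSigma i)^n) c i
      - ((apSigma j * apSigma i)^n) c j = (∑ k, c k) - c i - c j) := by
  induction n with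
  | zero => simp
  | succ n ih =>
    obtain ⟨h1, h2, h3, h4⟩ := ih
    rw [pow_succ', LinearEquiv.mul_apply]
    set y := ((apSigma j * apSigma i)^n) c with hy
    rw [LinearEquiv.mul_apply]
    have ei : apSigma j (apSigma i y) i = 2 * (∑ k, y k) - 3 * y i := by
      rw [apSigma_apply j, Function.update_of_ne hij, apSigma_apply, Function.update_self]
    have ej : apSigma j (apSigma i y) j = 2 * (3 * (∑ k, y k) - 4 * y i) - 3 * y j := by
      rw [apSigma_apply j, Function.update_self, sum_apSigma, apSigma_apply,
        Function.update_of_ne hij.symm]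
    have ey : apSigma i y j = y j := by
      rw [apSigma_apply, Function.update_of_ne hij.symm]
    have hs : ∑ k, y k = y i + y j + ((∑ k, c k) - c i - c j) := by linarith
    refine ⟨?_, ?_, ?_, ?_⟩
    · rw [ei, hs, h1, h2]; push_cast; ring
    · rw [ej, hs, h1, h2]; push_cast; ring
    · intro k hk hk'
      rw [apSigma_apply j, Function.update_of_ne hk', apSigma_apply, Function.update_of_ne hk]
      exact h3 k hk hk'
    · rw [ei, ej, sum_apSigma, sum_apSigma, ey]; linarith

lemma quad_lb (S d a m : ℝ) (hS : 0 < S) :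
    a - (d - S)^2 / (4*S) ≤ a + m * d + S * (m * (m-1)) := by
  have : a + m * d + S * (m * (m-1)) - (a - (d - S)^2 / (4*S)) = (2*S*m + (d-S))^2/(4*S) := by
    field_simp
    ring
  have h2 : 0 ≤ (2*S*m + (d-S))^2/(4*S) := by positivity
  linarith

/-- If some `W*`-translate of `s` has two or more nonpositive coordinates, then `Z(s)`
diverges. -/
theorem not_summable_of_two_nonpos (c : Fin 4 → ℝ) (hc : IsBaseQuadruple c)
    (s : Fin 4 → ℝ)
    (h : ∃ w ∈ apWstar, ∃ i j : Fin 4, i ≠ j ∧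
      (w : (Fin 4 → ℝ) ≃ₗ[ℝ] (Fin 4 → ℝ)) s i ≤ 0 ∧ (w : (Fin 4 → ℝ) ≃ₗ[ℝ] (Fin 4 → ℝ)) s j ≤ 0) :
    ¬ Summable fun w : apW => Real.exp (-pairR ((w : (Fin 4 → ℝ) ≃ₗ[ℝ] (Fin 4 → ℝ)) c) s) := by
  obtain ⟨w, hw, i, j, hij, hi, hj⟩ := h
  obtain ⟨u, hu, hadj⟩ := exists_adj w hw
  have hg : apSigma j * apSigma i ∈ apW := mul_mem (apSigma_mem j) (apSigma_mem i)
  intro hsum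
  let φ : ℕ → apW := fun n => ⟨u * (apSigma j * apSigma i)^n, mul_mem hu (pow_mem hg n)⟩
  have hφ : Function.Injective φ := by
    intro m n hmn
    have h1 : (apSigma j * apSigma i)^m = (apSigma j * apSigma i)^n :=
      mul_left_cancel (Subtype.ext_iff.mp hmn)
    have h2 := (iter i j hij (Pi.single j 1) m).1
    rw [h1, (iter i j hij (Pi.single j 1) n).1] at h2
    simp [hij] at h2
    exact h2.symm
  have hlim := (hsum.comp_injective hφ).tendsto_atTop_zero
  set S := (∑ k, c k) - c i - c j with hSdef
  have hS : 0 < S := base_pos c hc i j hij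
  set B := c i - ((c j - c i) - S)^2 / (4*S) with hB
  have hbd : ∀ n, Real.exp (-(∑ k, if k = i ∨ k = j then B * w s k else c k * w s k)) ≤
      ((fun w : apW => Real.exp (-pairR ((w : (Fin 4 → ℝ) ≃ₗ[ℝ] (Fin 4 → ℝ)) c) s)) ∘ φ) n := by
    intro n
    obtain ⟨h1, h2, h3, -⟩ := iter i j hij c n
    simp only [Function.comp, φ]
    rw [LinearEquiv.mul_apply, hadj]
    apply Real.exp_le_exp.mpr
    apply neg_le_neg
    unfold pairR
    apply Finset.sum_le_sum
    intro k _
    split_ifs with hk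
    · rcases hk with rfl | rfl
      · apply mul_le_mul_of_nonpos_right _ hi
        rw [h1]
        exact quad_lb S _ _ _ hS
      · apply mul_le_mul_of_nonpos_right _ hj
        rw [h2]
        have := quad_lb S (c k - c i) (c i) (2*n+1) hS
        rw [add_sub_cancel_right] at this
        exact this
    · push Not at hk
      rw [h3 k hk.1 hk.2]
  have := ge_of_tendsto' hlim hbd
  exact absurd this (not_le.mpr (Real.exp_pos _))
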